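/- Let E and F be finite-dimensional real inner product spaces, let 0 < c ≤ C, and let V : E × F → ℝ satisfy c ≤ HV ≤ C (in particular V is continuously differentiable). Suppose W : E × F × [0, ∞) → E satisfies W(x, y, 0) = x and ∂_t W(x, y, t) = −(1/2) ∇_x V(W(x, y, t), y) for all (x, y, t). Then for all t ≥ 0, x, x' ∈ E, and y, y' ∈ F, ‖W(x, y, t) − W(x', y', t)‖ ≤ e^{−ct/2} ‖x − x'‖ + (C/c)(1 − e^{−ct/2}) ‖y − y'‖. -/

import Mathlib

open Set

open Filter Topology

/-- A convex function on a finite-dimensional space has a subgradient at every point. -/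
theorem ConvexOn.exists_subgradient {G : Type*} [NormedAddCommGroup G] [NormedSpace ℝ G]
    [FiniteDimensional ℝ G] {f : G → ℝ} (hf : ConvexOn ℝ univ f) (p : G) :
    ∃ l : G →L[ℝ] ℝ, ∀ q, f p + l (q - p) ≤ f q := by
  have hcont : Continuous f := hf.locallyLipschitz.continuous
  obtain ⟨m, hm⟩ := geometric_hahn_banach_point_open
    (t := {r : G × ℝ | r.1 ∈ univ ∧ f r.1 < r.2}) (x := (p, f p)) hf.convex_strict_epigraph
    (by simpa using isOpen_lt (hcont.comp continuous_fst) continuous_snd) (by simp)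
  have hsplit (q : G) (s : ℝ) : m (q, s) = m (q, 0) + s * m (0, 1) := by
    rw [← smul_eq_mul, ← map_smul, ← map_add]
    simp
  set a := m (0, 1) with ha_def
  have ha : 0 < a := by
    have := hm (p, f p + 1) (by simp)
    rw [hsplit, hsplit p (f p + 1)] at this
    linarith
  have hle (q : G) : m (p, 0) + f p * a ≤ m (q, 0) + f q * a := by
    refine le_of_forall_pos_lt_add fun ε hε => ?_
    have := hm (q, f q + ε / a) (by simp; positivity)
    rw [hsplit, hsplit q] at this
    calc _ < _ := this
      _ = _ := by field_simp; ring
  refine ⟨-(a⁻¹ • m.comp (.inl ℝ G ℝ)), fun q => ?_⟩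
  have hsub : m (q - p, 0) = m (q, 0) - m (p, 0) := by
    rw [← map_sub]
    simp
  have := hle q
  simp only [neg_apply, smul_apply,
    ContinuousLinearMap.comp_apply, ContinuousLinearMap.inl_apply, smul_eq_mul, hsub]
  rw [← sub_nonneg]
  have h : f q - (f p + -(a⁻¹ * (m (q, 0) - m (p, 0))))
      = a⁻¹ * ((m (q, 0) + f q * a) - (m (p, 0) + f p * a)) := by
    field_simp
    ring
  rw [h]
  exact mul_nonneg (inv_nonneg.2 ha.le) (sub_nonneg.2 this)

theorem eq_zero_of_forall_mul_le_mul_sq {a K : ℝ} (h : ∀ s : ℝ, s * a ≤ K * s ^ 2) : a = 0 := by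
  have hK : 0 ≤ K := by
    have h1 := h 1
    have h2 := h (-1)
    linarith
  have h1 := h (a / (K + 1))
  have h2 : 0 < K + 1 := by linarith
  have h3 : a / (K + 1) * a = (K + 1) * (a / (K + 1)) ^ 2 := by field_simp
  have h4 : a / (K + 1) = 0 := by nlinarith [sq_nonneg (a / (K + 1))]
  simpa [h2.ne'] using h4

section Product

variable {E F : Type*} [NormedAddCommGroup E] [InnerProductSpace ℝ E]
  [NormedAddCommGroup F] [InnerProductSpace ℝ F]

theorem norm_sq_add_norm_sq_eq_expand (p q : E × F) :
    ‖q.1‖ ^ 2 + ‖q.2‖ ^ 2 = ‖p.1‖ ^ 2 + ‖p.2‖ ^ 2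
      + 2 * (innerSL ℝ p.1).coprod (innerSL ℝ p.2) (q - p)
      + (‖(q - p).1‖ ^ 2 + ‖(q - p).2‖ ^ 2) := by
  have h1 := norm_add_sq_real p.1 (q - p).1
  have h2 := norm_add_sq_real p.2 (q - p).2
  simp only [Prod.fst_sub, Prod.snd_sub, add_sub_cancel] at h1 h2
  simp only [ContinuousLinearMap.coprod_apply, innerSL_apply_apply, Prod.fst_sub, Prod.snd_sub]
  linarith

/-- If `c ≤ HV ≤ C` then at every point `V` lies between two paraboloids with the same tangent. -/
theorem exists_quadratic_bounds [FiniteDimensional ℝ E] [FiniteDimensional ℝ F] {c C : ℝ}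
    {V : E × F → ℝ}
    (hconv : ConvexOn ℝ univ (fun p : E × F => V p - c / 2 * (‖p.1‖ ^ 2 + ‖p.2‖ ^ 2)))
    (hconc : ConcaveOn ℝ univ (fun p : E × F => V p - C / 2 * (‖p.1‖ ^ 2 + ‖p.2‖ ^ 2)))
    (p : E × F) :
    ∃ L : E × F →L[ℝ] ℝ, ∀ h : E × F,
      V p + L h + c / 2 * (‖h.1‖ ^ 2 + ‖h.2‖ ^ 2) ≤ V (p + h) ∧
      V (p + h) ≤ V p + L h + C / 2 * (‖h.1‖ ^ 2 + ‖h.2‖ ^ 2) := by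
  obtain ⟨l₁, h₁⟩ := hconv.exists_subgradient p
  obtain ⟨l₂, h₂⟩ := hconc.neg.exists_subgradient p
  set M := (innerSL ℝ p.1).coprod (innerSL ℝ p.2) with hM
  have lower (h : E × F) :
      V p + (l₁ + c • M) h + c / 2 * (‖h.1‖ ^ 2 + ‖h.2‖ ^ 2) ≤ V (p + h) := by
    have e := norm_sq_add_norm_sq_eq_expand p (p + h)
    have := h₁ (p + h)
    rw [← hM] at e
    simp only [add_sub_cancel_left] at e this
    rw [e] at this
    simp only [add_apply, smul_apply, smul_eq_mul]
    linarith
  have upper (h : E × F) :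
      V (p + h) ≤ V p + (-l₂ + C • M) h + C / 2 * (‖h.1‖ ^ 2 + ‖h.2‖ ^ 2) := by
    have e := norm_sq_add_norm_sq_eq_expand p (p + h)
    have := h₂ (p + h)
    rw [← hM] at e
    simp only [add_sub_cancel_left, Pi.neg_apply] at e this
    rw [e] at this
    simp only [add_apply, smul_apply, smul_eq_mul,
      neg_apply]
    linarith
  have heq : l₁ + c • M = -l₂ + C • M := by
    refine ContinuousLinearMap.ext fun h => ?_
    rw [← sub_eq_zero]
    refine eq_zero_of_forall_mul_le_mul_sq
      (K := (C - c) / 2 * (‖h.1‖ ^ 2 + ‖h.2‖ ^ 2)) fun s => ?_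
    have := (lower (s • h)).trans (upper (s • h))
    simp only [map_smul, smul_eq_mul, Prod.smul_fst, Prod.smul_snd, norm_smul, mul_pow,
      Real.norm_eq_abs, sq_abs] at this
    linarith
  exact ⟨l₁ + c • M, fun h => ⟨lower h, heq ▸ upper h⟩⟩

theorem inner_gradient_of_quadratic_bounds [CompleteSpace E] {c C : ℝ} (hc : 0 ≤ c)
    {V : E × F → ℝ} {x : E} {y : F} {L : E × F →L[ℝ] ℝ}
    (hL : ∀ h : E × F,
      V (x, y) + L h + c / 2 * (‖h.1‖ ^ 2 + ‖h.2‖ ^ 2) ≤ V ((x, y) + h) ∧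
      V ((x, y) + h) ≤ V (x, y) + L h + C / 2 * (‖h.1‖ ^ 2 + ‖h.2‖ ^ 2)) (u : E) :
    inner ℝ (gradient (fun x' => V (x', y)) x) u = L (u, 0) := by
  have hO : (fun x' => V (x', y) - (V (x, y) + L.comp (.inl ℝ E F) (x' - x)))
      =O[𝓝 x] fun x' => ‖x' - x‖ ^ 2 := by
    refine Asymptotics.IsBigO.of_bound (C / 2) (Eventually.of_forall fun x' => ?_)
    obtain ⟨h1, h2⟩ := hL (x' - x, 0)
    have h3 : 0 ≤ c / 2 * ‖x' - x‖ ^ 2 := by positivity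
    simp only [norm_zero, Prod.mk_add_mk, add_sub_cancel, add_zero, ne_eq, OfNat.ofNat_ne_zero,
      not_false_eq_true, zero_pow] at h1 h2
    simp only [ContinuousLinearMap.comp_apply, ContinuousLinearMap.inl_apply, norm_pow, norm_norm]
    rw [Real.norm_eq_abs, abs_le]
    constructor <;> linarith
  have hd := (hO.hasFDerivAt one_lt_two).add
    (((L.comp (.inl ℝ E F)).hasFDerivAt.comp x ((hasFDerivAt_id x).sub_const x)).const_add
      (V (x, y)))
  have hd' : HasFDerivAt (fun x' => V (x', y)) (L.comp (.inl ℝ E F)) x := by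
    refine (hd.congr_fderiv (by simp)).congr_of_eventuallyEq (Eventually.of_forall fun x' => ?_)
    simp
  rw [gradient, hd'.fderiv, InnerProductSpace.toDual_symm_apply]
  simp

theorem inner_gradient_sub_bounds [FiniteDimensional ℝ E] [FiniteDimensional ℝ F]
    {c C : ℝ} (hc : 0 < c) (hcC : c ≤ C) {V : E × F → ℝ}
    (hconv : ConvexOn ℝ univ (fun p : E × F => V p - c / 2 * (‖p.1‖ ^ 2 + ‖p.2‖ ^ 2)))
    (hconc : ConcaveOn ℝ univ (fun p : E × F => V p - C / 2 * (‖p.1‖ ^ 2 + ‖p.2‖ ^ 2))) :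
    (∀ (x x' : E) (y : F), c * ‖x - x'‖ ^ 2 ≤
      inner ℝ (gradient (fun z => V (z, y)) x - gradient (fun z => V (z, y)) x') (x - x')) ∧
    ∀ (x : E) (y y' : F),
      ‖gradient (fun z => V (z, y)) x - gradient (fun z => V (z, y')) x‖ ≤ C * ‖y - y'‖ := by
  choose L hL using exists_quadratic_bounds hconv hconc
  have hg (x : E) (y : F) (u : E) := inner_gradient_of_quadratic_bounds hc.le (hL (x, y)) u
  have hC : 0 < C := hc.trans_le hcC
  refine ⟨fun x x' y => ?_, fun x y y' => ?_⟩
  · have h1 := (hL (x, y) (x' - x, 0)).1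
    have h2 := (hL (x', y) (x - x', 0)).1
    have h3 : L (x, y) (x' - x, 0) = -L (x, y) (x - x', 0) := by
      rw [← map_neg]
      simp
    simp only [norm_zero, Prod.mk_add_mk, add_sub_cancel, add_zero, ne_eq, OfNat.ofNat_ne_zero,
      not_false_eq_true, zero_pow] at h1 h2
    rw [norm_sub_rev x' x] at h1
    rw [inner_sub_left, hg, hg]
    linarith
  · set g := gradient (fun z => V (z, y)) x - gradient (fun z => V (z, y')) x with hgdef
    -- Evaluate `V` at `(x, y') + k` and `(x, y) - k` with `k` built from `g` and `y - y'`.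
    have key : 4 * C⁻¹ * ‖g‖ ^ 2 ≤ C * ‖y - y'‖ ^ 2 := by
      set k : E × F := (C⁻¹ • g, (1 / 2 : ℝ) • (y - y')) with hk
      set d : E × F := (0, y - y') with hd
      have e1 : (x, y') + k = (x, y) + (k - d) := by
        simp only [hk, hd]
        ext <;> simp
        abel
      have e2 : (x, y) - k = (x, y') + (d - k) := by
        simp only [hk, hd]
        ext <;> simp <;> abel
      have h1 := (hL (x, y) (k - d)).1
      have h2 := (hL (x, y') k).2
      have h3 := (hL (x, y') (d - k)).1
      have h4 := (hL (x, y) (-k)).2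
      rw [← e1] at h1
      rw [← e2] at h3
      rw [← sub_eq_add_neg] at h4
      have p1 : 0 ≤ c / 2 * (‖(k - d).1‖ ^ 2 + ‖(k - d).2‖ ^ 2) := by positivity
      have p2 : 0 ≤ c / 2 * (‖(d - k).1‖ ^ 2 + ‖(d - k).2‖ ^ 2) := by positivity
      have hkd : k = (C⁻¹ • (g, (0 : F))) + (1 / 2 : ℝ) • d := by
        simp only [hk, hd]
        ext <;> simp
      have nk1 : ‖k.1‖ ^ 2 = C⁻¹ ^ 2 * ‖g‖ ^ 2 := by
        simp [hk, norm_smul, mul_pow]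
      have nk2 : ‖k.2‖ ^ 2 = 1 / 4 * ‖y - y'‖ ^ 2 := by
        simp only [hk, norm_smul, mul_pow]
        norm_num
      have hD : L (x, y) (g, 0) - L (x, y') (g, 0) = ‖g‖ ^ 2 := by
        rw [← hg, ← hg, ← inner_sub_left, ← hgdef, real_inner_self_eq_norm_sq]
      have l1 (p : E × F) : L p k = C⁻¹ * L p (g, 0) + 1 / 2 * L p d := by
        conv_lhs => rw [hkd]
        rw [map_add, map_smul, map_smul, smul_eq_mul, smul_eq_mul]
      simp only [map_sub, map_neg, l1, Prod.fst_neg, Prod.snd_neg, norm_neg, nk1, nk2]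
        at h1 h2 h3 h4
      have hCC : C * (C⁻¹ ^ 2 * ‖g‖ ^ 2) = C⁻¹ * ‖g‖ ^ 2 := by field_simp
      have hDC : C⁻¹ * L (x, y) (g, 0) - C⁻¹ * L (x, y') (g, 0) = C⁻¹ * ‖g‖ ^ 2 := by
        rw [← hD]
        ring
      linarith
    have hsq : (2 * ‖g‖) ^ 2 ≤ (C * ‖y - y'‖) ^ 2 := by
      calc (2 * ‖g‖) ^ 2 = C * (4 * C⁻¹ * ‖g‖ ^ 2) := by field_simp; ring
        _ ≤ C * (C * ‖y - y'‖ ^ 2) := by gcongr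
        _ = _ := by ring
    have := abs_le_of_sq_le_sq' hsq (by positivity)
    linarith [this.2, norm_nonneg g]

end Product

/-- Gronwall's inequality for the norm of a curve whose radial velocity is controlled. -/
theorem norm_le_gronwallBound_of_inner_deriv_le {E : Type*} [NormedAddCommGroup E]
    [InnerProductSpace ℝ E] {z z' : ℝ → E} {K ε : ℝ}
    (hz : ∀ t ∈ Ici (0 : ℝ), HasDerivWithinAt z (z' t) (Ici 0) t)
    (hzero : ∀ t ∈ Ici (0 : ℝ), z t = 0 → ‖z' t‖ ≤ ε)
    (hinner : ∀ t ∈ Ici (0 : ℝ), inner ℝ (z t) (z' t) ≤ K * ‖z t‖ ^ 2 + ε * ‖z t‖)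
    {t : ℝ} (ht : 0 ≤ t) : ‖z t‖ ≤ gronwallBound ‖z 0‖ K ε t := by
  have hcont : ContinuousOn (fun s => ‖z s‖) (Icc 0 t) := fun s hs =>
    (((hz s hs.1).mono Icc_subset_Ici_self).continuousWithinAt).norm
  have := le_gronwallBound_of_liminf_deriv_right_le (f' := fun s => K * ‖z s‖ + ε) hcont
    ?_ le_rfl (fun _ _ => le_rfl) t ⟨ht, le_rfl⟩
  · simpa using this
  intro s hs r hr
  have hs0 : s ∈ Ici (0 : ℝ) := hs.1
  have hd : HasDerivWithinAt z (z' s) (Ici s) s := (hz s hs0).mono (Ici_subset_Ici.2 hs0)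
  by_cases h0 : z s = 0
  · refine hd.liminf_right_slope_norm_le (lt_of_le_of_lt (hzero s hs0 h0) ?_)
    simpa [h0] using hr
  · have hpos : 0 < ‖z s‖ := norm_pos_iff.2 h0
    have hn : HasDerivWithinAt (fun s => ‖z s‖) (2 * inner ℝ (z s) (z' s) / (2 * ‖z s‖))
        (Ici s) s := by
      simpa using hd.norm_sq.sqrt (by positivity)
    have hlt : 2 * inner ℝ (z s) (z' s) / (2 * ‖z s‖) < r := by
      refine lt_of_le_of_lt ?_ hr
      rw [div_le_iff₀ (by positivity)]
      linarith [hinner s hs0]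
    simpa [slope_def_field, div_eq_inv_mul] using hn.liminf_right_slope_le hlt

/-- contraction estimate for the gradient flow of a uniformly convex and
semi-concave potential `V` on `E × F` (flowing only in the `E`-variable, with `y` as a
parameter). -/
theorem stmt10 {E F : Type*}
    [NormedAddCommGroup E] [InnerProductSpace ℝ E] [FiniteDimensional ℝ E]
    [NormedAddCommGroup F] [InnerProductSpace ℝ F] [FiniteDimensional ℝ F]
    (c C : ℝ) (hc : 0 < c) (hcC : c ≤ C) (V : E × F → ℝ)
    (hconv : ConvexOn ℝ univ
      (fun p : E × F => V p - c / 2 * (‖p.1‖ ^ 2 + ‖p.2‖ ^ 2)))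
    (hconc : ConcaveOn ℝ univ
      (fun p : E × F => V p - C / 2 * (‖p.1‖ ^ 2 + ‖p.2‖ ^ 2)))
    (W : E → F → ℝ → E)
    (hW0 : ∀ (x : E) (y : F), W x y 0 = x)
    (hWode : ∀ (x : E) (y : F), ∀ t ∈ Ici (0 : ℝ),
      HasDerivWithinAt (W x y)
        (-(1 / 2 : ℝ) • gradient (fun x' => V (x', y)) (W x y t)) (Ici 0) t) :
    ∀ t ∈ Ici (0 : ℝ), ∀ (x x' : E) (y y' : F),
      ‖W x y t - W x' y' t‖ ≤
        Real.exp (-c * t / 2) * ‖x - x'‖ +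
          C / c * (1 - Real.exp (-c * t / 2)) * ‖y - y'‖ := by
  intro t ht x x' y y'
  obtain ⟨hmono, hlip⟩ := inner_gradient_sub_bounds hc hcC hconv hconc
  have hC : 0 < C := hc.trans_le hcC
  set g : E → F → E := fun x y => gradient (fun z => V (z, y)) x with hg
  have hgron := norm_le_gronwallBound_of_inner_deriv_le (K := -(c / 2)) (ε := C / 2 * ‖y - y'‖)
    (fun s hs => (hWode x y s hs).sub (hWode x' y' s hs)) ?_ ?_ ht
  · rw [gronwallBound_of_K_ne_0 (by linarith)] at hgron
    simp only [Pi.sub_apply, hW0] at hgron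
    have hexp : -(c / 2) * t = -c * t / 2 := by ring
    rw [hexp] at hgron
    refine hgron.trans_eq ?_
    field_simp
    ring
  · intro s _ hs
    have heq : W x y s = W x' y' s := sub_eq_zero.1 hs
    rw [heq, ← smul_sub, norm_smul]
    have := hlip (W x' y' s) y y'
    norm_num
    linarith
  · intro s _
    simp only [Pi.sub_apply]
    set w := W x y s
    set w' := W x' y' s
    have h1 := hmono w w' y
    have h2 := hlip w' y y'
    have h3 := real_inner_le_norm (g w' y' - g w' y) (w - w')
    have h4 : ‖g w' y' - g w' y‖ * ‖w - w'‖ ≤ C * ‖y - y'‖ * ‖w - w'‖ := by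
      rw [norm_sub_rev]
      gcongr
    have h5 : inner ℝ (w - w') (-(1 / 2 : ℝ) • g w y - -(1 / 2 : ℝ) • g w' y')
        = -(1 / 2) * inner ℝ (g w y - g w' y) (w - w')
          + 1 / 2 * inner ℝ (g w' y' - g w' y) (w - w') := by
      rw [← smul_sub, real_inner_comm, real_inner_smul_left]
      simp only [inner_sub_left]
      ring
    change inner ℝ (w - w') (-(1 / 2 : ℝ) • g w y - -(1 / 2 : ℝ) • g w' y') ≤ _
    rw [h5]
    change c * ‖w - w'‖ ^ 2 ≤ inner ℝ (g w y - g w' y) (w - w') at h1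
    linarith
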